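/- arXiv:math/0111174 — 2 statements merged into one kernel-verified Lean document; each statement's English description precedes it below -/
import Mathlib

section
/- Let R be a commutative ring and let φ : R^m → R^n and ψ : R^p → R^q be R-linear maps. Then the integral closure of the ideal I(φ ⊗ ψ) equals the integral closure of the ideal I(φ)^q · I(ψ)^n. -/
noncomputable section

/-- `I_t(A)`: the ideal of `R` generated by the `t × t` minors of the matrix `A`. -/
def minorsIdeal {R : Type*} [CommRing R] (t : ℕ) {N M : Type*} (A : Matrix N M R) : Ideal R :=
  Ideal.span {x : R | ∃ (r : Fin t → N) (c : Fin t → M), x = (A.submatrix r c).det}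

/-- The integral closure of an ideal `I ⊆ R`: the set of `x ∈ R` satisfying an equation
`x^k + a_1 x^{k-1} + ⋯ + a_k = 0` with `a_i ∈ I^i` for all `i`. -/
def Ideal.intClosure {R : Type*} [CommRing R] (I : Ideal R) : Set R :=
  {x : R | ∃ k : ℕ, 0 < k ∧ ∃ a : ℕ → R, (∀ i ∈ Finset.Icc 1 k, a i ∈ I ^ i) ∧
      x ^ k + ∑ i ∈ Finset.Icc 1 k, a i * x ^ (k - i) = 0}

theorem Ideal.mem_intClosure_of_sum_eq_zero {R : Type*} [CommRing R] {I : Ideal R} {x : R} {k : ℕ}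
    (hk : 0 < k) (f : ℕ → R) (hf : ∀ j, f j ∈ I ^ (k - j)) (hfk : f k = 1)
    (h : ∑ j ∈ Finset.range (k + 1), f j * x ^ j = 0) : x ∈ I.intClosure := by
  refine ⟨k, hk, fun i => f (k - i), fun i hi => ?_, ?_⟩
  · have h1 := hf (k - i)
    rwa [Nat.sub_sub_self (Finset.mem_Icc.1 hi).2] at h1
  · rw [Finset.sum_range_succ, hfk, one_mul, add_comm] at h
    rw [← h]
    congr 1
    refine Finset.sum_nbij' (fun i => k - i) (fun j => k - j) ?_ ?_ ?_ ?_ ?_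
    all_goals intro i hi; simp only [Finset.mem_Icc, Finset.mem_range] at hi ⊢
    all_goals omega

open Polynomial in
theorem Ideal.isIntegral_monomial_of_mem_intClosure {R : Type*} [CommRing R] {I : Ideal R} {x : R}
    (hx : x ∈ I.intClosure) : IsIntegral (reesAlgebra I) (monomial 1 x : R[X]) := by
  obtain ⟨k, hk, a, ha, h⟩ := hx
  have hmem : ∀ i ∈ Finset.Icc 1 k, (monomial i (a i) : R[X]) ∈ reesAlgebra I :=
    fun i hi => reesAlgebra.monomial_mem.2 (ha i hi)
  refine ⟨X ^ k + ∑ i ∈ (Finset.Icc 1 k).attach,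
    C (⟨monomial i.1 (a i.1), hmem i.1 i.2⟩ : reesAlgebra I) * X ^ (k - i.1), ?_, ?_⟩
  · refine monic_X_pow_add ((degree_sum_le _ _).trans_lt ?_)
    refine (Finset.sup_lt_iff (WithBot.bot_lt_coe k)).2 fun i _ => ?_
    refine (degree_C_mul_X_pow_le _ _).trans_lt ?_
    have := Finset.mem_Icc.1 i.2
    exact WithBot.coe_lt_coe.2 (show k - i.1 < k by omega)
  · rw [eval₂_add, eval₂_pow, eval₂_X, eval₂_finsetSum]
    simp only [eval₂_mul, eval₂_C, eval₂_pow, eval₂_X]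
    have h1 : ∀ i ∈ (Finset.Icc 1 k).attach,
        algebraMap (reesAlgebra I) R[X] ⟨monomial i.1 (a i.1), hmem i.1 i.2⟩
          * (monomial 1 x) ^ (k - i.1) = monomial k (a i.1 * x ^ (k - i.1)) := by
      intro i _
      have := Finset.mem_Icc.1 i.2
      rw [monomial_pow, one_mul]
      change monomial i.1 (a i.1) * _ = _
      rw [monomial_mul_monomial, Nat.add_sub_cancel' this.2]
    rw [Finset.sum_congr rfl h1,
      Finset.sum_attach (Finset.Icc 1 k) (fun i => (monomial k (a i * x ^ (k - i)) : R[X])),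
      ← map_sum, monomial_pow, one_mul, ← map_add, h, map_zero]

open Polynomial in
theorem Ideal.mem_intClosure_of_isIntegral_monomial {R : Type*} [CommRing R] {I : Ideal R} {x : R}
    (hx : IsIntegral (reesAlgebra I) (monomial 1 x : R[X])) : x ∈ I.intClosure := by
  obtain ⟨p, hp, h⟩ := hx
  rcases subsingleton_or_nontrivial R with _ | _
  · exact ⟨1, one_pos, 0, fun _ _ => zero_mem _, Subsingleton.elim _ _⟩
  set q := p * X with hq
  have hqm : q.Monic := hp.mul monic_X
  have hqd : q.natDegree = p.natDegree + 1 := natDegree_mul_X hp.ne_zero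
  have h0 : eval₂ (algebraMap (reesAlgebra I) R[X]) (monomial 1 x) q = 0 := by
    rw [hq, eval₂_mul, h, zero_mul]
  set k := q.natDegree with hk
  refine mem_intClosure_of_sum_eq_zero (k := k) (by omega)
    (fun j => (q.coeff j : R[X]).coeff (k - j)) (fun j => (q.coeff j).2 _) ?_ ?_
  · rw [hk, coeff_natDegree, hqm.leadingCoeff]
    simp
  · have h1 := congrArg (fun r : R[X] => r.coeff k) h0
    simp only [eval₂_eq_sum_range, finsetSum_coeff, coeff_zero] at h1
    rw [← h1]
    refine Finset.sum_congr rfl fun j hj => ?_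
    have hj' : j ≤ k := Nat.lt_succ_iff.1 (Finset.mem_range.1 hj)
    rw [monomial_pow, one_mul]
    change _ = ((q.coeff j : R[X]) * monomial j (x ^ j)).coeff k
    conv_rhs => rw [← Nat.sub_add_cancel hj']
    rw [coeff_mul_monomial]

open Polynomial in
theorem Ideal.intClosure_subset_intClosure {R : Type*} [CommRing R] {I : Ideal R} {s : Set R}
    (hs : s ⊆ I.intClosure) : (Ideal.span s).intClosure ⊆ I.intClosure := by
  intro x hx
  have hle : reesAlgebra (Ideal.span s) ≤
      (integralClosure (reesAlgebra I) R[X]).restrictScalars R := by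
    rw [← adjoin_monomial_eq_reesAlgebra, Algebra.adjoin_le_iff]
    rintro _ ⟨y, hy, rfl⟩
    change IsIntegral (reesAlgebra I) (monomial 1 y : R[X])
    refine Submodule.span_induction (fun y hy => isIntegral_monomial_of_mem_intClosure (hs hy))
      ?_ (fun y z _ _ h1 h2 => ?_) (fun r y _ h1 => ?_) hy
    · rw [map_zero]; exact isIntegral_zero
    · rw [map_add]; exact h1.add h2
    · rw [map_smul, ← algebraMap_smul (reesAlgebra I) r]
      exact h1.smul _
  obtain ⟨p, hp, h⟩ := isIntegral_monomial_of_mem_intClosure hx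
  refine mem_intClosure_of_isIntegral_monomial ?_
  have : IsIntegral (integralClosure (reesAlgebra I) R[X]) (monomial 1 x : R[X]) := by
    refine ⟨p.map ((reesAlgebra (span s)).val.toRingHom.codRestrict
      (integralClosure (reesAlgebra I) R[X]) fun y => hle y.2), hp.map _, ?_⟩
    rw [eval₂_map]
    exact h
  exact isIntegral_trans (R := reesAlgebra I) _ this

open Polynomial in
theorem Ideal.mem_intClosure_of_mul_mem {R : Type*} [CommRing R] {I Q : Ideal R} (hQ : Q.FG) {x : R}
    (h : ∀ y ∈ Q, x * y ∈ I * Q) {t : ℕ} (hx : x ^ t ∈ Q) : x ∈ I.intClosure := by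
  have : Module.Finite R Q := Module.Finite.iff_fg.2 hQ
  obtain ⟨p, hp, -, hc, h0⟩ :=
    LinearMap.exists_monic_and_natDegree_eq_and_coeff_mem_pow_and_aeval_eq_zero R
      (algebraMap R (Module.End R Q) x) I (by
        rintro _ ⟨y, rfl⟩
        rw [Submodule.mem_smul_top_iff]
        exact h y y.2)
  rw [aeval_algebraMap_apply] at h0
  have h1 : p.eval x * x ^ t = 0 := by
    have := congrArg Subtype.val (LinearMap.congr_fun h0 ⟨x ^ t, hx⟩)
    simpa using this
  refine mem_intClosure_of_sum_eq_zero (k := p.natDegree + (t + 1)) (by omega)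
    (fun j => (p * X ^ (t + 1)).coeff j) (fun j => ?_) ?_ ?_
  · rw [coeff_mul_X_pow']
    split_ifs with hj
    · have := hc (j - (t + 1))
      rwa [show p.natDegree + (t + 1) - j = p.natDegree - (j - (t + 1)) by omega]
    · exact zero_mem _
  · rw [coeff_mul_X_pow, hp.coeff_natDegree]
  · rw [← eval_eq_sum_range' (p := p * X ^ (t + 1))]
    · rw [eval_mul, eval_pow, eval_X, pow_succ, ← mul_assoc, h1, zero_mul]
    · refine Nat.lt_succ_of_le (natDegree_mul_le.trans ?_)
      gcongr
      exact natDegree_X_pow_le _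

theorem Ideal.exists_pow_le_span_pow_mul {R : Type*} [CommRing R] {ι : Type*} [Fintype ι]
    (u : ι → R) (k : ℕ) :
    ∃ N, Ideal.span (Set.range u) ^ (N + k) ≤
      Ideal.span (Set.range fun i => u i ^ k) * Ideal.span (Set.range u) ^ N := by
  classical
  refine ⟨Fintype.card ι * k + 1, ?_⟩
  set N := Fintype.card ι * k + 1 with hN
  rw [Ideal.span, Submodule.span_pow, Submodule.span_le]
  intro y hy
  obtain ⟨f, hf, rfl⟩ := Set.mem_pow_iff_prod.1 hy
  choose g hg using hf
  obtain ⟨i, hi⟩ := Fintype.exists_lt_card_fiber_of_mul_lt_card (f := g) (n := k)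
    (by rw [Fintype.card_fin]; omega)
  obtain ⟨s, hs, hsk⟩ := Finset.exists_subset_card_eq hi.le
  rw [← Finset.prod_mul_prod_compl s]
  refine Ideal.mul_mem_mul ?_ ?_
  · rw [Finset.prod_congr rfl fun j hj => show f j = u i by
      rw [← hg j, (Finset.mem_filter.1 (hs hj)).2], Finset.prod_const, hsk]
    exact Ideal.subset_span ⟨i, rfl⟩
  · have hc : sᶜ.card = N := by rw [Finset.card_compl, hsk, Fintype.card_fin]; omega
    have := Ideal.prod_mem_prod (s := sᶜ) (I := fun _ => Ideal.span (Set.range u)) (x := f)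
      fun j _ => hg j ▸ Ideal.subset_span ⟨g j, rfl⟩
    rwa [Finset.prod_const, hc] at this

theorem Ideal.mem_intClosure_of_pow_mul_mem {R : Type*} [CommRing R] {ι : Type*} [Fintype ι]
    {u : ι → R} {K : Ideal R} {k : ℕ} {x : R}
    (h : ∀ i, u i ^ k * x ∈ K * Ideal.span (Set.range u) ^ k) {t : ℕ}
    (hx : x ^ t ∈ Ideal.span (Set.range u)) : x ∈ K.intClosure := by
  obtain ⟨N, hN⟩ := Ideal.exists_pow_le_span_pow_mul u k
  set Q := Ideal.span (Set.range u) with hQ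
  have hfg : Q.FG := Submodule.fg_span (Set.finite_range u)
  refine Ideal.mem_intClosure_of_mul_mem (Q := Q ^ (N + k)) (hfg.pow) (t := t * (N + k)) ?_
    (by rw [pow_mul]; exact Ideal.pow_mem_pow hx _)
  have hle : Ideal.span {x} * Ideal.span (Set.range fun i => u i ^ k) ≤ K * Q ^ k := by
    rw [Ideal.span_singleton_mul_le_iff]
    intro z hz
    induction hz using Submodule.span_induction with
    | mem z hz => obtain ⟨i, rfl⟩ := hz; exact mul_comm (u i ^ k) x ▸ h i
    | zero => rw [mul_zero]; exact zero_mem _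
    | add a b _ _ ha hb => rw [mul_add]; exact add_mem ha hb
    | smul r a _ ha => rw [mul_smul_comm]; exact Submodule.smul_mem _ _ ha
  intro y hy
  have h1 : x * y ∈ Ideal.span {x} *
      (Ideal.span (Set.range fun i => u i ^ k) * Q ^ N) :=
    Ideal.mul_mem_mul (Ideal.mem_span_singleton_self x) (hN hy)
  rw [← mul_assoc] at h1
  have h2 := Ideal.mul_mono_left (K := Q ^ N) hle h1
  rwa [mul_assoc, ← pow_add, add_comm k N] at h2

theorem Matrix.det_mem_pow {R : Type*} [CommRing R] {N : Type*} [Fintype N] [DecidableEq N]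
    {I : Ideal R} {A : Matrix N N R} (h : ∀ i j, A i j ∈ I) : A.det ∈ I ^ Fintype.card N := by
  rw [Matrix.det_apply']
  refine Ideal.sum_mem _ fun σ _ => Ideal.mul_mem_left _ _ ?_
  have := Ideal.prod_mem_prod (s := Finset.univ) (I := fun _ : N => I)
    (x := fun i => A (σ i) i) fun i _ => h _ _
  rwa [Finset.prod_const, Finset.card_univ] at this

theorem minorsIdeal_eq_span_range {R : Type*} [CommRing R] {N M : Type*} [Fintype N]
    [DecidableEq N] {t : ℕ} (ht : Fintype.card N = t) (A : Matrix N M R) :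
    minorsIdeal t A = Ideal.span (Set.range fun c : N → M => (A.submatrix id c).det) := by
  refine le_antisymm (Ideal.span_le.2 ?_) (Ideal.span_le.2 ?_)
  · rintro _ ⟨r, c, rfl⟩
    by_cases hr : Function.Injective r
    · have hb := (Fintype.bijective_iff_injective_and_card r).2 ⟨hr, by simp [ht]⟩
      refine Ideal.subset_span ⟨c ∘ (Equiv.ofBijective r hb).symm, ?_⟩
      change (A.submatrix id (c ∘ (Equiv.ofBijective r hb).symm)).det = _
      rw [← Matrix.det_submatrix_equiv_self (Equiv.ofBijective r hb), Matrix.submatrix_submatrix]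
      congr 2
      ext i
      simp
    · rw [Function.Injective] at hr
      push Not at hr
      obtain ⟨i, j, hij, hne⟩ := hr
      rw [Matrix.det_zero_of_row_eq hne (by ext; simp [hij])]
      exact zero_mem _
  · rintro _ ⟨c, rfl⟩
    let e : Fin t ≃ N := (Fintype.equivFinOfCardEq ht).symm
    refine Ideal.subset_span ⟨e, c ∘ e, ?_⟩
    change (A.submatrix id c).det = _
    rw [← Matrix.det_submatrix_equiv_self e, Matrix.submatrix_submatrix]
    rfl

theorem det_submatrix_id_mem_minorsIdeal {R : Type*} [CommRing R] {N M : Type*} [Fintype N]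
    [DecidableEq N] (A : Matrix N M R) (c : N → M) :
    (A.submatrix id c).det ∈ minorsIdeal (Fintype.card N) A := by
  rw [minorsIdeal_eq_span_range rfl]
  exact Ideal.subset_span ⟨c, rfl⟩

theorem adjugate_submatrix_mul_apply_mem_minorsIdeal {R : Type*} [CommRing R] {N M : Type*}
    [Fintype N] [DecidableEq N] (A : Matrix N M R) (c : N → M) (i : N) (j : M) :
    ((A.submatrix id c).adjugate * A) i j ∈ minorsIdeal (Fintype.card N) A := by
  classical
  have h : ((A.submatrix id c).adjugate * A) i j =
      (A.submatrix id (Function.update c i j)).det := by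
    have := congrFun (Matrix.cramer_eq_adjugate_mulVec (A.submatrix id c) (A.col j)) i
    rw [Matrix.cramer_apply] at this
    refine Eq.trans ?_ (this.symm.trans ?_)
    · rfl
    · congr 1
      ext a b
      by_cases hb : b = i
      · subst hb; simp
      · simp [hb]
  rw [h]
  exact det_submatrix_id_mem_minorsIdeal _ _

/-- The determinant of a square matrix with entries `A x.1 (g e) * X x.2 e` lies in the ideal of
maximal minors of `A`. -/
theorem det_mul_mem_minorsIdeal {R : Type*} [CommRing R] {N M κ : Type*} [Fintype N]
    [DecidableEq N] [Fintype κ] [DecidableEq κ] [Nonempty κ] (A : Matrix N M R)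
    (g : N × κ → M) (X : Matrix κ (N × κ) R) :
    (Matrix.of fun (x : N × κ) e => A x.1 (g e) * X x.2 e).det
      ∈ minorsIdeal (Fintype.card N) A := by
  classical
  have h1 : (Matrix.of fun (x : N × κ) e => A x.1 (g e) * X x.2 e).det =
      ∑ u : N × κ → κ, (∏ e, X (u e) e) *
        (Matrix.of fun (x : N × κ) e => if x.2 = u e then A x.1 (g e) else 0).det := by
    simp_rw [Matrix.det_apply', Finset.mul_sum]
    rw [Finset.sum_comm]
    refine Finset.sum_congr rfl fun σ _ => ?_
    have h2 : ∀ e, (Matrix.of fun (x : N × κ) e => A x.1 (g e) * X x.2 e) (σ e) e =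
        ∑ j, X j e * if (σ e).2 = j then A (σ e).1 (g e) else 0 := by
      intro e
      simp [mul_comm]
    simp_rw [h2]
    rw [Fintype.prod_sum, Finset.mul_sum]
    refine Finset.sum_congr rfl fun u _ => ?_
    rw [Finset.prod_mul_distrib]
    simp only [Matrix.of_apply]
    ring
  rw [h1]
  refine Ideal.sum_mem _ fun u _ => Ideal.mul_mem_left _ _ ?_
  by_cases hu : ∃ σ : Equiv.Perm (N × κ), ∀ e, (σ e).2 = u e
  · obtain ⟨σ, hσ⟩ := hu
    set B : Matrix (N × κ) (N × κ) R :=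
      Matrix.of fun x e => if x.2 = u e then A x.1 (g e) else 0 with hB
    have h3 : B.submatrix id σ.symm =
        Matrix.blockDiagonal fun k => A.submatrix id fun i => g (σ.symm (i, k)) := by
      ext ⟨i, k⟩ ⟨i', k'⟩
      simp only [hB, Matrix.submatrix_apply, Matrix.of_apply, Matrix.blockDiagonal_apply, ← hσ,
        Equiv.apply_symm_apply, id]
      split_ifs with h
      · rw [h]
      · rfl
    have h4 := Matrix.det_permute' σ.symm B
    rw [h3, Matrix.det_blockDiagonal] at h4
    have h5 : B.det = (Equiv.Perm.sign σ.symm : R) *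
        ∏ k, (A.submatrix id fun i => g (σ.symm (i, k))).det := by
      rw [h4, ← mul_assoc, ← Int.cast_mul, Int.units_coe_mul_self, Int.cast_one, one_mul]
    rw [h5]
    obtain ⟨k⟩ := ‹Nonempty κ›
    rw [← Finset.mul_prod_erase _ _ (Finset.mem_univ k)]
    exact Ideal.mul_mem_left _ _
      (Ideal.mul_mem_right _ _ (det_submatrix_id_mem_minorsIdeal _ _))
  · push Not at hu
    rw [Matrix.det_apply', Finset.sum_eq_zero]
    · exact zero_mem _
    · intro σ _
      obtain ⟨e, he⟩ := hu σ
      rw [Finset.prod_eq_zero (Finset.mem_univ e), mul_zero]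
      simp [he]

open scoped Kronecker in
theorem det_kronecker_submatrix_mem_minorsIdeal_mul {R : Type*} [CommRing R] {N M Q P : Type*}
    [Fintype N] [DecidableEq N] [Fintype Q] [DecidableEq Q] [Nonempty N] [Nonempty Q]
    (A : Matrix N M R) (B : Matrix Q P R) (g : N × Q → M × P) :
    ((A ⊗ₖ B).submatrix id g).det ^ 2
      ∈ minorsIdeal (Fintype.card N) A * minorsIdeal (Fintype.card Q) B := by
  rw [sq]
  refine Ideal.mul_mem_mul
    (det_mul_mem_minorsIdeal A (fun e => (g e).1) (Matrix.of fun j e => B j (g e).2)) ?_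
  rw [← Matrix.det_submatrix_equiv_self (Equiv.prodComm Q N)]
  convert det_mul_mem_minorsIdeal B (fun e => (g e.swap).2)
    (Matrix.of fun i e => A i (g e.swap).1) using 2
  ext x e
  simp [Matrix.kroneckerMap_apply, mul_comm]

open scoped Kronecker in
theorem pow_mul_det_kronecker_submatrix_mem {R : Type*} [CommRing R] {N M Q P : Type*}
    [Fintype N] [DecidableEq N] [Fintype Q] [DecidableEq Q]
    (A : Matrix N M R) (B : Matrix Q P R) (g : N × Q → M × P) (c : N → M) (d : Q → P) :
    ((A.submatrix id c).det * (B.submatrix id d).det) ^ (Fintype.card N * Fintype.card Q) *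
        ((A ⊗ₖ B).submatrix id g).det ∈
      (minorsIdeal (Fintype.card N) A ^ Fintype.card Q *
        minorsIdeal (Fintype.card Q) B ^ Fintype.card N) *
      (minorsIdeal (Fintype.card N) A * minorsIdeal (Fintype.card Q) B) ^
        (Fintype.card N * Fintype.card Q) := by
  have h1 : ((A.submatrix id c) ⊗ₖ (B.submatrix id d)) *
      ((((A.submatrix id c).adjugate * A) ⊗ₖ ((B.submatrix id d).adjugate * B)).submatrix id g) =
      ((A.submatrix id c).det * (B.submatrix id d).det) • (A ⊗ₖ B).submatrix id g := by
    have h2 := Matrix.mul_kronecker_mul (A.submatrix id c) ((A.submatrix id c).adjugate * A)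
      (B.submatrix id d) ((B.submatrix id d).adjugate * B)
    rw [← Matrix.mul_assoc, ← Matrix.mul_assoc, Matrix.mul_adjugate, Matrix.mul_adjugate,
      Matrix.smul_mul, Matrix.smul_mul, Matrix.one_mul, Matrix.one_mul, Matrix.smul_kronecker,
      Matrix.kronecker_smul, smul_smul] at h2
    ext i j
    have := congrFun (congrFun h2 i) (g j)
    exact this.symm
  have h3 := congrArg Matrix.det h1
  rw [Matrix.det_mul, Matrix.det_smul, Fintype.card_prod, Matrix.det_kronecker] at h3
  rw [← h3]
  refine Ideal.mul_mem_mul (Ideal.mul_mem_mul ?_ ?_) ?_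
  · exact Ideal.pow_mem_pow (det_submatrix_id_mem_minorsIdeal _ _) _
  · exact Ideal.pow_mem_pow (det_submatrix_id_mem_minorsIdeal _ _) _
  · rw [← Fintype.card_prod]
    refine Matrix.det_mem_pow fun i j => Ideal.mul_mem_mul ?_ ?_
    · exact adjugate_submatrix_mul_apply_mem_minorsIdeal _ _ _ _
    · exact adjugate_submatrix_mul_apply_mem_minorsIdeal _ _ _ _

open scoped Kronecker in
theorem det_kronecker_submatrix_mem_intClosure {R : Type*} [CommRing R] {N M Q P : Type*}
    [Fintype N] [DecidableEq N] [Fintype Q] [DecidableEq Q] [Finite M] [Finite P]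
    [Nonempty N] [Nonempty Q]
    (A : Matrix N M R) (B : Matrix Q P R) (g : N × Q → M × P) :
    ((A ⊗ₖ B).submatrix id g).det ∈
      (minorsIdeal (Fintype.card N) A ^ Fintype.card Q *
        minorsIdeal (Fintype.card Q) B ^ Fintype.card N).intClosure := by
  classical
  have := Fintype.ofFinite M
  have := Fintype.ofFinite P
  let u : (N → M) × (Q → P) → R :=
    fun x => (A.submatrix id x.1).det * (B.submatrix id x.2).det
  have hu : Ideal.span (Set.range u) =
      minorsIdeal (Fintype.card N) A * minorsIdeal (Fintype.card Q) B := by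
    rw [minorsIdeal_eq_span_range rfl, minorsIdeal_eq_span_range rfl, Ideal.span_mul_span']
    congr 1
    ext y
    simp [u, Set.mem_mul]
  refine Ideal.mem_intClosure_of_pow_mul_mem (u := u) (k := Fintype.card N * Fintype.card Q)
    (t := 2) (fun x => ?_) ?_
  · rw [hu]
    exact pow_mul_det_kronecker_submatrix_mem A B g x.1 x.2
  · rw [hu]
    exact det_kronecker_submatrix_mem_minorsIdeal_mul A B g

open scoped Kronecker in
/-- The `nq`-th power of a generator of `I(A)^q I(B)^n` lies in the `nq`-th power of the ideal of
maximal minors of `A ⊗ B`. -/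
theorem prod_mul_prod_pow_mem {R : Type*} [CommRing R] {N M Q P : Type*}
    [Fintype N] [DecidableEq N] [Fintype Q] [DecidableEq Q]
    (A : Matrix N M R) (B : Matrix Q P R) (c : Q → N → M) (d : N → Q → P) :
    ((∏ j, (A.submatrix id (c j)).det) * ∏ i, (B.submatrix id (d i)).det) ^
        (Fintype.card N * Fintype.card Q) ∈
      minorsIdeal (Fintype.card N * Fintype.card Q) (A ⊗ₖ B) ^
        (Fintype.card N * Fintype.card Q) := by
  have h1 : ((∏ j, (A.submatrix id (c j)).det) * ∏ i, (B.submatrix id (d i)).det) ^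
        (Fintype.card N * Fintype.card Q) =
      ∏ x : N × Q, ((A ⊗ₖ B).submatrix id (Prod.map (c x.2) (d x.1))).det := by
    have h2 : ∀ x : N × Q, ((A ⊗ₖ B).submatrix id (Prod.map (c x.2) (d x.1))).det =
        (A.submatrix id (c x.2)).det ^ Fintype.card Q *
          (B.submatrix id (d x.1)).det ^ Fintype.card N :=
      fun x => Matrix.det_kronecker (A.submatrix id (c x.2)) (B.submatrix id (d x.1))
    simp_rw [h2]
    rw [Finset.prod_mul_distrib, Fintype.prod_prod_type_right, Fintype.prod_prod_type]
    simp only [Finset.prod_const, Finset.card_univ, Finset.prod_pow]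
    ring
  rw [h1, ← Fintype.card_prod, ← Finset.card_univ, ← Finset.prod_const]
  exact Ideal.prod_mem_prod fun x _ => det_submatrix_id_mem_minorsIdeal _ _

open scoped Kronecker in
/-- For a commutative ring `R` and linear maps `φ : R^m → R^n`, `ψ : R^p → R^q`, the ideals
`I(φ ⊗ ψ)` and `I(φ)^q · I(ψ)^n` have the same integral closure. -/
theorem intClosure_maximalMinors_kronecker {R : Type*} [CommRing R] {m n p q : ℕ}
    (φ : Matrix (Fin n) (Fin m) R) (ψ : Matrix (Fin q) (Fin p) R) :
    (minorsIdeal (n * q) (φ ⊗ₖ ψ)).intClosure =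
      (minorsIdeal n φ ^ q * minorsIdeal q ψ ^ n).intClosure := by
  rcases Nat.eq_zero_or_pos (n * q) with h0 | h0
  · have htop : ∀ {N M : Type} (A : Matrix N M R), minorsIdeal 0 A = ⊤ := fun A =>
      (Ideal.eq_top_iff_one _).2
        (Ideal.subset_span ⟨Fin.elim0, Fin.elim0, by rw [Matrix.det_isEmpty]⟩)
    congr 1
    rw [h0, htop]
    rcases Nat.mul_eq_zero.1 h0 with rfl | rfl
    · rw [htop, pow_zero, Ideal.one_eq_top, Ideal.top_pow, Ideal.top_mul]
    · rw [htop, pow_zero, Ideal.one_eq_top, Ideal.top_pow, Ideal.top_mul]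
  have : NeZero n := ⟨by rintro rfl; simp at h0⟩
  have : NeZero q := ⟨by rintro rfl; simp at h0⟩
  apply Set.Subset.antisymm
  · rw [minorsIdeal_eq_span_range (by simp) (φ ⊗ₖ ψ)]
    refine Ideal.intClosure_subset_intClosure ?_
    rintro _ ⟨g, rfl⟩
    simpa only [Fintype.card_fin] using det_kronecker_submatrix_mem_intClosure φ ψ g
  · rw [minorsIdeal_eq_span_range (Fintype.card_fin n) φ,
      minorsIdeal_eq_span_range (Fintype.card_fin q) ψ, Ideal.span, Ideal.span,
      Submodule.span_pow, Submodule.span_pow]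
    refine (congrArg Ideal.intClosure (Ideal.span_mul_span' _ _)).subset.trans ?_
    refine Ideal.intClosure_subset_intClosure ?_
    rintro _ ⟨y, hy, z, hz, rfl⟩
    obtain ⟨f, hf, rfl⟩ := Set.mem_pow_iff_prod.1 hy
    obtain ⟨g, hg, rfl⟩ := Set.mem_pow_iff_prod.1 hz
    choose c hc using hf
    choose d hd using hg
    have hmem := prod_mul_prod_pow_mem φ ψ c d
    simp only [Fintype.card_fin] at hmem hc hd
    simp only [hc, hd] at hmem
    refine ⟨n * q, h0, fun i => if i = n * q then
      -((∏ i, f i) * ∏ i, g i) ^ (n * q) else 0, fun i _ => ?_, ?_⟩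
    · dsimp only
      split_ifs with hi
      · rw [hi]; exact neg_mem hmem
      · exact zero_mem _
    · rw [Finset.sum_eq_single (n * q)]
      · simp
      · intro i _ hi; simp [hi]
      · intro hi; exact absurd (Finset.mem_Icc.2 ⟨h0, le_rfl⟩) hi
end
end

section
/- Let X = (X_{ij}) be an m×n matrix of indeterminates and Y = (Y_{kl}) a p×q matrix of indeterminates, and let R = ℤ[X, Y] be the polynomial ring over ℤ in all of these variables. Let I(X) ⊆ R be the ideal generated by the n×n minors of X (assuming m ≥ n) and I(Y) ⊆ R the ideal generated by the q×q minors of Y (assuming p ≥ q). Then I(X)^q · I(Y)^n = I(X)^q ∩ I(Y)^n. -/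
noncomputable section

/-- `cutWeight M i j` is the minimal total weight, with respect to the weights `M`, of a cut
which separates the columns `0, …, j` of the first `i` rows, in the sense of
`exists_cut_le_cutWeight`. -/
def cutWeight (M : ℕ → ℕ → ℕ) : ℕ → ℕ → ℕ
  | 0, _ => 0
  | i + 1, 0 => cutWeight M i 0 + M i 0
  | i + 1, j + 1 => min (cutWeight M i (j + 1) + M i (j + 1)) (cutWeight M i j)

theorem cutWeight_le_succ_left_and_succ_right_le (M : ℕ → ℕ → ℕ) (i j : ℕ) :
    cutWeight M i j ≤ cutWeight M (i + 1) j ∧ cutWeight M i (j + 1) ≤ cutWeight M i j := by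
  induction i generalizing j with
  | zero => simp [cutWeight]
  | succ i ih =>
    have key : ∀ j, cutWeight M (i + 1) (j + 1) ≤ cutWeight M (i + 1) j := fun j ↦
      (min_le_right _ _).trans (ih j).1
    refine ⟨?_, key j⟩
    cases j with
    | zero => simp [cutWeight]
    | succ j =>
      rw [cutWeight.eq_3 M (i + 1) j]
      exact le_min (Nat.le_add_right _ _) (key j)

theorem cutWeight_monotone (M : ℕ → ℕ → ℕ) (j : ℕ) : Monotone fun i ↦ cutWeight M i j :=
  monotone_nat_of_le_succ fun i ↦ (cutWeight_le_succ_left_and_succ_right_le M i j).1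

theorem cutWeight_antitone (M : ℕ → ℕ → ℕ) (i : ℕ) : Antitone (cutWeight M i) :=
  antitone_nat_of_succ_le fun j ↦ (cutWeight_le_succ_left_and_succ_right_le M i j).2

theorem cutWeight_succ_le (M : ℕ → ℕ → ℕ) (i j : ℕ) :
    cutWeight M (i + 1) j ≤ cutWeight M i j + M i j := by
  cases j with
  | zero => simp [cutWeight]
  | succ j => exact min_le_left _ _

theorem exists_cutWeight_le_lt {M : ℕ → ℕ → ℕ} {m j t : ℕ} (h : t < cutWeight M m j) :
    ∃ i < m, cutWeight M i j ≤ t ∧ t < cutWeight M (i + 1) j := by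
  induction m with
  | zero => simp [cutWeight] at h
  | succ m ih =>
    by_cases h' : t < cutWeight M m j
    · obtain ⟨i, hi, h⟩ := ih h'
      exact ⟨i, by omega, h⟩
    · exact ⟨m, by omega, by omega, h⟩

theorem exists_cut_le_cutWeight (M : ℕ → ℕ → ℕ) (i j : ℕ) (hj : j ≤ i) :
    ∃ r κ : ℕ → ℕ, (∀ a b, a < b → b < j → r a < r b) ∧ (∀ a < j, r a < i) ∧
      (∀ k < i, κ k ≤ j ∧ ∀ a < j, r a < k ↔ a < κ k) ∧
      ∑ k ∈ Finset.range i with ∀ a < j, r a ≠ k, M k (κ k) ≤ cutWeight M i j := by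
  induction i generalizing j with
  | zero =>
    obtain rfl : j = 0 := by omega
    exact ⟨id, id, by simp⟩
  | succ i ih =>
    obtain rfl | hj' : j = i + 1 ∨ j ≤ i := by omega
    · refine ⟨id, id, fun a b h _ ↦ h, fun a h ↦ h, fun k hk ↦ ⟨hk.le, by simp⟩, ?_⟩
      rw [Finset.filter_false_of_mem, Finset.sum_empty]
      · exact Nat.zero_le _
      · intro k hk h
        exact h k (Finset.mem_range.1 hk) rfl
    have first : cutWeight M (i + 1) j = cutWeight M i j + M i j →
        ∃ r κ : ℕ → ℕ, (∀ a b, a < b → b < j → r a < r b) ∧ (∀ a < j, r a < i + 1) ∧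
          (∀ k < i + 1, κ k ≤ j ∧ ∀ a < j, r a < k ↔ a < κ k) ∧
          ∑ k ∈ Finset.range (i + 1) with ∀ a < j, r a ≠ k, M k (κ k) ≤
            cutWeight M (i + 1) j := by
      intro hcut
      obtain ⟨r, κ, hr, hri, hκ, hsum⟩ := ih j hj'
      refine ⟨r, Function.update κ i j, hr, fun a ha ↦ (hri a ha).trans (Nat.lt_succ_self i),
        fun k hk ↦ ?_, ?_⟩
      · rcases Nat.lt_succ_iff_lt_or_eq.1 hk with hk | rfl
        · simpa [Function.update_of_ne hk.ne] using hκ k hk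
        · simp +contextual [hri]
      · rw [hcut, Finset.range_add_one, Finset.filter_insert,
          if_pos fun a ha ↦ (hri a ha).ne, Finset.sum_insert (by simp), add_comm]
        simp only [Function.update_self]
        refine Nat.add_le_add_right (le_of_eq_of_le (Finset.sum_congr rfl fun k hk ↦ ?_) hsum) _
        rw [Function.update_of_ne (by simp at hk; omega)]
    cases j with
    | zero => exact first rfl
    | succ j =>
      rcases min_choice (cutWeight M i (j + 1) + M i (j + 1)) (cutWeight M i j) with h | h
      · exact first h
      obtain ⟨r, κ, hr, hri, hκ, hsum⟩ := ih j (by omega)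
      have hu : ∀ a < j, Function.update r j i a = r a := fun a ha ↦
        Function.update_of_ne ha.ne _ _
      refine ⟨Function.update r j i, Function.update κ i j, fun a b hab hb ↦ ?_, fun a ha ↦ ?_,
        fun k hk ↦ ?_, ?_⟩
      · rcases Nat.lt_succ_iff_lt_or_eq.1 hb with hb | rfl
        · rw [hu a (by omega), hu b hb]
          exact hr a b hab hb
        · rw [hu a hab, Function.update_self]
          exact hri a hab
      · rcases Nat.lt_succ_iff_lt_or_eq.1 ha with ha | rfl
        · rw [hu a ha]
          exact (hri a ha).trans (Nat.lt_succ_self i)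
        · simp
      · rcases Nat.lt_succ_iff_lt_or_eq.1 hk with hk | rfl
        · rw [Function.update_of_ne hk.ne]
          refine ⟨(hκ k hk).1.trans (Nat.le_succ j), fun a ha ↦ ?_⟩
          rcases Nat.lt_succ_iff_lt_or_eq.1 ha with ha | rfl
          · rw [hu a ha]
            exact (hκ k hk).2 a ha
          · have := (hκ k hk).1
            simp only [Function.update_self]
            omega
        · simp only [Function.update_self]
          refine ⟨Nat.le_succ j, fun a ha ↦ ?_⟩
          rcases Nat.lt_succ_iff_lt_or_eq.1 ha with ha | rfl
          · rw [hu a ha]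
            simp [ha, hri a ha]
          · simp
      · rw [cutWeight, h, Finset.range_add_one, Finset.filter_insert,
          if_neg fun H ↦ H j (Nat.lt_succ_self j) (by simp)]
        refine le_of_eq_of_le (Finset.sum_congr ?_ fun k hk ↦ ?_) hsum
        · refine Finset.filter_congr fun k hk ↦ ⟨fun H a ha ↦ ?_, fun H a ha ↦ ?_⟩
          · rw [← hu a ha]
            exact H a (by omega)
          · rcases Nat.lt_succ_iff_lt_or_eq.1 ha with ha | rfl
            · rw [hu a ha]
              exact H a ha
            · simp at hk ⊢
              omega
        · rw [Function.update_of_ne (by simp at hk; omega)]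

theorem exists_chains_of_le_cutWeight {M : ℕ → ℕ → ℕ} {m ν s : ℕ} (h : s ≤ cutWeight M m ν) :
    ∃ a : ℕ → ℕ → ℕ, (∀ t < s, ∀ j ≤ ν, a t j < m) ∧
      (∀ t < s, ∀ j < ν, a t j < a t (j + 1)) ∧
      ∀ i, ∀ j ≤ ν, ((Finset.range s).filter fun t ↦ a t j = i).card ≤ M i j := by
  have key : ∀ t j, ∃ i, t < s → j ≤ ν →
      i < m ∧ cutWeight M i j ≤ t ∧ t < cutWeight M (i + 1) j := by
    intro t j
    by_cases H : t < s ∧ j ≤ ν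
    · obtain ⟨i, hi⟩ := exists_cutWeight_le_lt
        ((H.1.trans_le h).trans_le (cutWeight_antitone M m H.2))
      exact ⟨i, fun _ _ ↦ hi⟩
    · exact ⟨0, fun h1 h2 ↦ (H ⟨h1, h2⟩).elim⟩
  choose a ha using key
  refine ⟨a, fun t ht j hj ↦ (ha t j ht hj).1, fun t ht j hj ↦ ?_, fun i j hj ↦ ?_⟩
  · by_contra! hlt
    have h1 := (ha t (j + 1) ht hj).2.2
    have h2 := (ha t j ht hj.le).2.1
    have h3 := cutWeight_monotone M j hlt
    have h4 : cutWeight M (a t (j + 1) + 1) (j + 1) ≤ cutWeight M (a t (j + 1)) j :=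
      min_le_right _ _
    simp only at h3
    omega
  · calc _ ≤ (Finset.Ico (cutWeight M i j) (cutWeight M (i + 1) j)).card := by
          refine Finset.card_le_card fun t ht ↦ ?_
          obtain ⟨hts, rfl⟩ := Finset.mem_filter.1 ht
          exact Finset.mem_Ico.2 (ha t j (Finset.mem_range.1 hts) hj).2
      _ ≤ M i j := by
          have := cutWeight_succ_le M i j
          rw [Nat.card_Ico]
          omega

theorem Derivation.map_mem_pow_of_mem_pow_succ {R A : Type*} [CommSemiring R]
    [CommSemiring A] [Algebra R A] (D : Derivation R A A) (I : Ideal A) {s : ℕ} {a : A}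
    (ha : a ∈ I ^ (s + 1)) : D a ∈ I ^ s := by
  induction s generalizing a with
  | zero => simp
  | succ s ih =>
    rw [pow_succ] at ha
    refine Submodule.mul_induction_on ha (fun x hx y hy ↦ ?_) fun x y hx hy ↦ ?_
    · rw [D.leibniz, smul_eq_mul, smul_eq_mul]
      refine add_mem (Ideal.mul_mem_right _ _ hx) ?_
      rw [pow_succ']
      exact Ideal.mul_mem_mul hy (ih hx)
    · rw [map_add]
      exact add_mem hx hy

/-- `φ` embeds the positions of an `m × n` matrix, ordered row by row, into `σ`. -/
def IsRowMajor {m n : ℕ} {σ : Type*} [LinearOrder σ] (φ : Fin m → Fin n → σ) : Prop :=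
  ∀ i j i' j', φ i j < φ i' j' ↔ i < i' ∨ i = i' ∧ j < j'

/-- The exponent of the product of the variables at the positions `(r k, c k)`. -/
def positionExponent {m n N : ℕ} {σ : Type*} (φ : Fin m → Fin n → σ) (r : Fin N → Fin m)
    (c : Fin N → Fin n) : σ →₀ ℕ :=
  ∑ k, Finsupp.single (φ (r k) (c k)) 1

/-- The matrix of the variables with the indices `φ i j`. -/
def variableMatrix {m n : ℕ} {σ : Type*} (φ : Fin m → Fin n → σ) :
    Matrix (Fin m) (Fin n) (MvPolynomial σ ℤ) :=
  Matrix.of fun i j ↦ MvPolynomial.X (φ i j)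

section

open MonomialOrder MvPolynomial Finsupp

open scoped MonomialOrder

variable {m n N : ℕ} {σ : Type*}

theorem degree_positionExponent (φ : Fin m → Fin n → σ) (r : Fin N → Fin m)
    (c : Fin N → Fin n) : (positionExponent φ r c).degree = N := by
  simp [positionExponent, map_sum]

theorem positionExponent_apply [DecidableEq σ] (φ : Fin m → Fin n → σ) (r : Fin N → Fin m)
    (c : Fin N → Fin n) (v : σ) :
    positionExponent φ r c v = ∑ k, if φ (r k) (c k) = v then 1 else 0 := by
  simp [positionExponent, Finsupp.finsetSum_apply, Finsupp.single_apply]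

theorem MonomialOrder.monic_and_degree_eq {M : MonomialOrder σ} {f : MvPolynomial σ ℤ}
    {u : σ →₀ ℕ} (hf : M.degree f ≼[M] u) (hu : f.coeff u = 1) :
    M.Monic f ∧ M.degree f = u := by
  have h : M.degree f = u :=
    M.toSyn.injective (le_antisymm hf (M.le_degree (by simp [hu])))
  exact ⟨by rw [Monic, leadingCoeff, h, hu], h⟩

theorem sum_variableMatrix_mul_minor_eq_zero {ν : ℕ} (φ : Fin m → Fin (ν + 1) → σ)
    (r : Fin ν → Fin m) (a : Fin ν) :
    ∑ k, X (φ (r a) k) * ((-1) ^ (k : ℕ) *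
      ((variableMatrix φ).submatrix r k.succAbove).det) = 0 := by
  have h : ((variableMatrix φ).submatrix (Fin.cons (r a) r : Fin (ν + 1) → Fin m) id).det = 0 :=
    Matrix.det_zero_of_row_eq (Fin.succ_ne_zero a).symm (by ext k; simp)
  rw [Matrix.det_succ_row_zero] at h
  rw [← h]
  refine Finset.sum_congr rfl fun k _ ↦ ?_
  simp only [Matrix.submatrix_apply, Matrix.submatrix_submatrix, Fin.cons_zero, id]
  rw [variableMatrix, Matrix.of_apply, mul_left_comm, ← mul_assoc]
  rfl

theorem aeval_eq_zero_of_mem_minorsIdeal {ν : ℕ} {φ : Fin m → Fin (ν + 1) → σ}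
    {e : σ → MvPolynomial σ ℤ} {w : Fin (ν + 1) → MvPolynomial σ ℤ} (hw : w ≠ 0)
    (he : ∀ i, ∑ k, e (φ i k) * w k = 0) {f : MvPolynomial σ ℤ}
    (hf : f ∈ minorsIdeal (ν + 1) (variableMatrix φ)) : aeval e f = 0 := by
  suffices h : minorsIdeal (ν + 1) (variableMatrix φ) ≤ RingHom.ker (aeval e).toRingHom from
    h hf
  refine Ideal.span_le.2 ?_
  rintro _ ⟨r, c, rfl⟩
  have hzero : (((variableMatrix φ).submatrix r id).map (aeval e)).det = 0 := by
    refine Matrix.exists_mulVec_eq_zero_iff.1 ⟨w, hw, funext fun i ↦ ?_⟩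
    simpa [Matrix.mulVec, dotProduct, variableMatrix] using he (r i)
  have hsub : (variableMatrix φ).submatrix r c = (variableMatrix φ).submatrix r id *
      (1 : Matrix (Fin (ν + 1)) (Fin (ν + 1)) (MvPolynomial σ ℤ)).submatrix id c := by
    ext i j : 2
    simp [Matrix.mul_apply, Matrix.one_apply]
  change aeval e _ = 0
  rw [hsub, Matrix.det_mul, map_mul, AlgHom.map_det]
  change (((variableMatrix φ).submatrix r id).map (aeval e)).det * _ = 0
  rw [hzero, zero_mul]

/-- If every leading monomial of `J` is divisible by the leading monomial of a monic element of
`K ≤ J`, then `K = J`. -/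
theorem MonomialOrder.le_of_forall_exists_monic (M : MonomialOrder σ)
    {J K : Ideal (MvPolynomial σ ℤ)} (hKJ : K ≤ J)
    (h : ∀ f ∈ J, f ≠ 0 → ∃ g ∈ K, M.Monic g ∧ M.degree g ≤ M.degree f) : J ≤ K := by
  classical
  intro f hf
  induction hd : M.toSyn (M.degree f) using WellFoundedLT.induction generalizing f with
  | ind d ih =>
  by_cases hf0 : f = 0
  · rw [hf0]
    exact zero_mem K
  obtain ⟨g, hgK, hg, hgf⟩ := h f hf hf0
  set t := monomial (M.degree f - M.degree g) (M.leadingCoeff f) * g with ht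
  have htK : t ∈ K := K.mul_mem_left _ hgK
  have hsub : M.degree f - M.degree g + M.degree g = M.degree f := tsub_add_cancel_of_le hgf
  have hle : M.degree t ≼[M] M.degree f := by
    refine M.degree_mul_le.trans ?_
    rw [map_add]
    refine (add_le_add_left (M.degree_monomial_le _) _).trans_eq ?_
    rw [← map_add, hsub]
  have hcoeff : coeff (M.degree f) (f - t) = 0 := by
    have : coeff (M.degree f) t = M.leadingCoeff f := by
      have h := coeff_monomial_mul (M.degree g) (M.degree f - M.degree g) (M.leadingCoeff f) g
      rwa [hsub, hg.coeff_degree, mul_one] at h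
    rw [coeff_sub, this, leadingCoeff, sub_self]
  suffices hft : f - t ∈ K by simpa using add_mem hft htK
  by_cases hft : f - t = 0
  · rw [hft]
    exact zero_mem K
  refine ih _ ?_ (sub_mem hf (hKJ htK)) rfl
  rw [← hd]
  refine lt_of_le_of_ne (M.degree_sub_le.trans (max_le le_rfl hle)) fun heq ↦ ?_
  rw [← M.toSyn.injective heq] at hcoeff
  exact M.coeff_degree_ne_zero_iff.2 hft hcoeff

variable [LinearOrder σ]

theorem IsRowMajor.injective {φ : Fin m → Fin n → σ} (hφ : IsRowMajor φ) {i i' : Fin m}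
    {j j' : Fin n} (h : φ i j = φ i' j') : i = i' ∧ j = j' := by
  have h1 := (hφ i j i' j').not.1 h.not_lt
  have h2 := (hφ i' j' i j).not.1 h.not_gt
  simp only [not_or, not_and, not_lt] at h1 h2
  have hi := le_antisymm h2.1 h1.1
  exact ⟨hi, le_antisymm (h2.2 hi.symm) (h1.2 hi)⟩

variable [WellFoundedGT σ]

theorem IsRowMajor.positionExponent_lt {φ : Fin m → Fin n → σ} (hφ : IsRowMajor φ)
    {r : Fin N → Fin m} (hr : StrictMono r) {c c' : Fin N → Fin n} {k₀ : Fin N}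
    (heq : ∀ k < k₀, c k = c' k) (hlt : c k₀ < c' k₀) :
    positionExponent φ r c' ≺[degLex] positionExponent φ r c := by
  have hge : ∀ k, ¬ k < k₀ → φ (r k₀) (c k₀) < φ (r k) (c' k) := by
    intro k hk
    rcases (not_lt.1 hk).lt_or_eq with hk | rfl
    · exact (hφ _ _ _ _).2 (Or.inl (hr hk))
    · exact (hφ _ _ _ _).2 (Or.inr ⟨rfl, hlt⟩)
  have hge' : ∀ k, ¬ k < k₀ → φ (r k₀) (c k₀) ≤ φ (r k) (c k) := by
    intro k hk
    rcases (not_lt.1 hk).lt_or_eq with hk | rfl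
    · exact ((hφ _ _ _ _).2 (Or.inl (hr hk))).le
    · exact le_rfl
  rw [degLex_lt_iff, DegLex.lt_iff]
  simp only [ofDegLex_toDegLex, degree_positionExponent, lt_self_iff_false, true_and, false_or]
  refine Finsupp.Lex.lt_iff.2 ⟨φ (r k₀) (c k₀), fun v hv ↦ ?_, ?_⟩
  · change positionExponent φ r c' v = positionExponent φ r c v
    rw [positionExponent_apply, positionExponent_apply]
    refine Finset.sum_congr rfl fun k _ ↦ ?_
    by_cases hk : k < k₀
    · rw [heq k hk]
    · rw [if_neg (hv.trans (hge k hk)).ne', if_neg (hv.trans_le (hge' k hk)).ne']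
  · change positionExponent φ r c' _ < positionExponent φ r c _
    rw [positionExponent_apply, positionExponent_apply]
    refine Finset.sum_lt_sum (fun k _ ↦ ?_) ⟨k₀, Finset.mem_univ _, ?_⟩
    · by_cases hk : k < k₀
      · rw [heq k hk]
      · rw [if_neg (hge k hk).ne']
        exact Nat.zero_le _
    · rw [if_neg (hge k₀ (lt_irrefl _)).ne', if_pos rfl]
      exact Nat.one_pos

theorem IsRowMajor.positionExponent_comp_lt {φ : Fin m → Fin n → σ} (hφ : IsRowMajor φ)
    {r : Fin N → Fin m} (hr : StrictMono r) {c : Fin N → Fin n} (hc : StrictMono c)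
    {τ : Fin N → Fin N} (hτ : Function.Injective τ) (hne : τ ≠ id) :
    positionExponent φ r (c ∘ τ) ≺[degLex] positionExponent φ r c := by
  obtain ⟨k₁, hk₁⟩ := Function.ne_iff.1 hne
  obtain ⟨k₀, hk₀, hmin⟩ := wellFounded_lt.has_min {k | τ k ≠ k} ⟨k₁, hk₁⟩
  have hfix : ∀ k < k₀, τ k = k := fun k hk ↦ by_contra fun h ↦ hmin k h hk
  refine hφ.positionExponent_lt hr (k₀ := k₀) (fun k hk ↦ by simp [hfix k hk]) (hc ?_)
  by_contra! h
  have h' := lt_of_le_of_ne h hk₀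
  exact hk₀ (hτ (hfix _ h'))

theorem IsRowMajor.positionExponent_comp_le {φ : Fin m → Fin n → σ} (hφ : IsRowMajor φ)
    {r : Fin N → Fin m} (hr : StrictMono r) {c : Fin N → Fin n} (hc : StrictMono c)
    {τ : Fin N → Fin N} (hτ : Function.Injective τ) :
    positionExponent φ r (c ∘ τ) ≼[degLex] positionExponent φ r c := by
  by_cases hne : τ = id
  · simp [hne]
  · exact (hφ.positionExponent_comp_lt hr hc hτ hne).le

theorem IsRowMajor.monic_det_and_degree_det {φ : Fin m → Fin n → σ} (hφ : IsRowMajor φ)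
    {r : Fin N → Fin m} (hr : StrictMono r) {c : Fin N → Fin n} (hc : StrictMono c) :
    degLex.Monic ((variableMatrix φ).submatrix r c).det ∧
      degLex.degree ((variableMatrix φ).submatrix r c).det = positionExponent φ r c := by
  have hprod : ∀ τ : Equiv.Perm (Fin N),
      ∏ k, ((variableMatrix φ).submatrix r c).transpose (τ k) k =
        monomial (positionExponent φ r (c ∘ τ)) (1 : ℤ) := by
    intro τ
    simp [variableMatrix, positionExponent, monomial_sum_one, X]
  have hdet : ((variableMatrix φ).submatrix r c).det =
      ∑ τ : Equiv.Perm (Fin N),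
        monomial (positionExponent φ r (c ∘ τ)) ((Equiv.Perm.sign τ : ℤ)) := by
    rw [← Matrix.det_transpose, Matrix.det_apply']
    refine Finset.sum_congr rfl fun τ _ ↦ ?_
    rw [hprod, ← map_intCast (C : ℤ →+* MvPolynomial σ ℤ), C_mul_monomial]
    simp
  refine monic_and_degree_eq ?_ ?_
  · rw [hdet, degree_le_iff]
    intro d hd
    obtain ⟨τ, -, hτ⟩ := Finset.mem_biUnion.1 (support_sum hd)
    rw [Finset.mem_singleton.1 (support_monomial_subset hτ)]
    exact hφ.positionExponent_comp_le hr hc τ.injective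
  · rw [hdet, coeff_sum, Finset.sum_eq_single 1]
    · simp
    · intro τ _ hτ
      rw [coeff_monomial, if_neg]
      intro h
      have := hφ.positionExponent_comp_lt hr hc τ.injective fun h ↦ hτ (Equiv.ext (congrFun h))
      rw [h] at this
      exact lt_irrefl _ this
    · simp

theorem IsRowMajor.single_add_positionExponent_le {ν : ℕ} {φ : Fin m → Fin (ν + 1) → σ}
    (hφ : IsRowMajor φ) {r : Fin ν → Fin m} (hr : StrictMono r) {i : Fin m}
    (hi : ∀ a, r a ≠ i) {k₀ : Fin (ν + 1)} (hk₀ : ∀ a, r a < i ↔ a.castSucc < k₀)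
    (k : Fin (ν + 1)) :
    single (φ i k) 1 + positionExponent φ r k.succAbove ≼[degLex]
      single (φ i k₀) 1 + positionExponent φ r k₀.succAbove := by
  have hexp : ∀ k : Fin (ν + 1), single (φ i k) 1 + positionExponent φ r k.succAbove =
      positionExponent φ (k₀.insertNth (α := fun _ ↦ Fin m) i r)
        (id ∘ k₀.insertNth (α := fun _ ↦ Fin (ν + 1)) k k.succAbove) := by
    intro k
    rw [positionExponent, positionExponent, Fin.sum_univ_succAbove _ k₀]
    simp
  have hmono : StrictMono (k₀.insertNth (α := fun _ ↦ Fin m) i r) := by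
    refine (Fin.strictMono_insertNth_iff k₀ i r).2 ⟨hr, fun a ha ↦ (hk₀ a).2 ha, fun a ha ↦ ?_⟩
    exact lt_of_le_of_ne (not_lt.1 ((hk₀ a).not.2 (not_lt.2 ha))) (hi a).symm
  have hid : k₀.insertNth (α := fun _ ↦ Fin (ν + 1)) k₀ k₀.succAbove = id := by
    funext x
    rcases Fin.eq_self_or_eq_succAbove k₀ x with rfl | ⟨a, rfl⟩ <;> simp
  rw [hexp k, hexp k₀, hid]
  refine hφ.positionExponent_comp_le hmono strictMono_id fun x y hxy ↦ ?_
  rcases Fin.eq_self_or_eq_succAbove k₀ x with rfl | ⟨a, rfl⟩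
  · rcases Fin.eq_self_or_eq_succAbove x y with rfl | ⟨b, rfl⟩
    · rfl
    · simp only [Fin.insertNth_apply_same, Fin.insertNth_apply_succAbove] at hxy
      exact (Fin.succAbove_ne _ _ hxy.symm).elim
  · rcases Fin.eq_self_or_eq_succAbove k₀ y with rfl | ⟨b, rfl⟩
    · simp only [Fin.insertNth_apply_same, Fin.insertNth_apply_succAbove] at hxy
      exact (Fin.succAbove_ne _ _ hxy).elim
    · simp only [Fin.insertNth_apply_succAbove] at hxy
      rw [Fin.succAbove_right_injective hxy]

theorem degree_prod_pow_le {e : σ → MvPolynomial σ ℤ} {μ : σ →₀ ℕ}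
    (he : ∀ v, degLex.degree (e v) ≼[degLex] single v 1 + μ) (d : σ →₀ ℕ) :
    degLex.degree (∏ v ∈ d.support, e v ^ d v) ≼[degLex] d + d.degree • μ := by
  have hd : d + d.degree • μ = ∑ v ∈ d.support, d v • (single v 1 + μ) := by
    simp only [smul_add, Finset.sum_add_distrib, ← Finset.sum_smul, Finsupp.degree]
    congr 1
    conv_lhs => rw [← d.sum_single]
    simp [Finsupp.sum]
  rw [hd]
  refine degLex.degree_prod_le.trans ?_
  rw [map_sum, map_sum]
  refine Finset.sum_le_sum fun v _ ↦ (degLex.degree_pow_le (d v)).trans ?_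
  rw [map_nsmul, map_nsmul]
  exact nsmul_le_nsmul_right (he v) (d v)

/-- A substitution which replaces every variable `v` by a polynomial of degree at most the one of
`δ * X v` does not kill a polynomial on whose leading monomial it is multiplication by `δ`. -/
theorem aeval_ne_zero_of_degree_le {e : σ → MvPolynomial σ ℤ} {δ f : MvPolynomial σ ℤ}
    (he : ∀ v, degLex.degree (e v) ≼[degLex] single v 1 + degLex.degree δ) (hδ : δ ≠ 0)
    (hf : f ≠ 0) (hfe : ∀ v ∈ (degLex.degree f).support, e v = δ * X v) :
    aeval e f ≠ 0 := by
  set μ := degLex.degree δ with hμ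
  set u := degLex.degree f with hu
  have hlt : ∀ d : σ →₀ ℕ, d ≺[degLex] u →
      d + d.degree • μ ≺[degLex] u + u.degree • μ := by
    intro d hd
    rw [map_add, map_add, map_nsmul, map_nsmul]
    refine add_lt_add_of_lt_of_le hd (nsmul_le_nsmul_left (zero_le _ _) ?_)
    exact DegLex.monotone_degree (α := σ) (a := toDegLex d) (b := toDegLex u) hd.le
  have hmain : coeff (u + u.degree • μ) (∏ v ∈ u.support, e v ^ u v) =
      degLex.leadingCoeff δ ^ u.degree := by
    have h1 : ∏ v ∈ u.support, e v ^ u v = monomial u 1 * δ ^ u.degree := by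
      rw [Finset.prod_congr rfl fun v hv ↦ by rw [hfe v hv, mul_pow], Finset.prod_mul_distrib,
        Finset.prod_pow_eq_pow_sum, mul_comm, monomial_eq, C_1, one_mul]
      rfl
    rw [h1, coeff_monomial_mul, one_mul, coeff_pow_nsmul_degree]
  intro h0
  have hcoeff : coeff (u + u.degree • μ) (aeval e f) =
      coeff u f * degLex.leadingCoeff δ ^ u.degree := by
    rw [aeval_def, eval₂_eq, coeff_sum, Finset.sum_eq_single u]
    · rw [algebraMap_eq, coeff_C_mul, hmain]
    · intro d hd hdu
      rw [algebraMap_eq, coeff_C_mul]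
      refine mul_eq_zero_of_right _ (degLex.coeff_eq_zero_of_lt ?_)
      refine (degree_prod_pow_le he d).trans_lt (hlt d ?_)
      exact lt_of_le_of_ne (degLex.le_degree hd) fun h ↦ hdu (degLex.toSyn.injective h)
    · intro h
      rw [MvPolynomial.notMem_support_iff.1 h, map_zero, zero_mul, coeff_zero]
  rw [h0, coeff_zero] at hcoeff
  exact mul_ne_zero (degLex.coeff_degree_ne_zero_iff.2 hf)
    (pow_ne_zero _ (degLex.leadingCoeff_ne_zero_iff.2 hδ)) hcoeff.symm

/-- A substitution `e` which kills the maximal minors, and multiplies by `δ` all variables except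
those at the positions `(i, κ i)` in the rows outside the range of `r`. -/
theorem IsRowMajor.exists_substitution {ν : ℕ} {φ : Fin m → Fin (ν + 1) → σ}
    (hφ : IsRowMajor φ) {r : Fin ν → Fin m} (hr : StrictMono r) {κ : Fin m → Fin (ν + 1)}
    (hκ : ∀ i, ∀ a, r a < i ↔ a.castSucc < κ i) :
    ∃ (e : σ → MvPolynomial σ ℤ) (w : Fin (ν + 1) → MvPolynomial σ ℤ)
      (δ : MvPolynomial σ ℤ), δ ≠ 0 ∧ w ≠ 0 ∧
      (∀ v, degLex.degree (e v) ≼[degLex] single v 1 + degLex.degree δ) ∧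
      (∀ v, (∀ i, (∀ a, r a ≠ i) → v ≠ φ i (κ i)) → e v = δ * X v) ∧
      ∀ i, ∑ k, e (φ i k) * w k = 0 := by
  classical
  set w : Fin (ν + 1) → MvPolynomial σ ℤ := fun k ↦
    (-1) ^ (k : ℕ) * ((variableMatrix φ).submatrix r k.succAbove).det with hw
  have hdet : ∀ k : Fin (ν + 1), degLex.Monic ((variableMatrix φ).submatrix r k.succAbove).det ∧
      degLex.degree ((variableMatrix φ).submatrix r k.succAbove).det =
        positionExponent φ r k.succAbove :=
    fun k ↦ hφ.monic_det_and_degree_det hr (Fin.strictMono_succAbove k)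
  have hw0 : ∀ k, w k ≠ 0 := fun k ↦
    mul_ne_zero (pow_ne_zero _ (neg_ne_zero.2 one_ne_zero)) (hdet k).1.ne_zero
  have hwdeg : ∀ k, degLex.degree (w k) = positionExponent φ r k.succAbove := by
    intro k
    rw [← (hdet k).2]
    rcases neg_one_pow_eq_or (MvPolynomial σ ℤ) (k : ℕ) with h | h <;>
      simp [hw, h, degree_neg]
  set δ := ∏ k, w k with hδ
  have hδ0 : δ ≠ 0 := Finset.prod_ne_zero_iff.2 fun k _ ↦ hw0 k
  let b : Fin m → MvPolynomial σ ℤ := fun i ↦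
    -((∏ k ∈ Finset.univ.erase (κ i), w k) *
      ∑ k ∈ Finset.univ.erase (κ i), X (φ i k) * w k)
  have hb : ∀ i, b i * w (κ i) = -∑ k ∈ Finset.univ.erase (κ i), δ * X (φ i k) * w k := by
    intro i
    rw [hδ, ← Finset.prod_erase_mul _ w (Finset.mem_univ (κ i))]
    simp only [b, mul_assoc, Finset.mul_sum, neg_mul, Finset.sum_mul]
    congr 1
    refine Finset.sum_congr rfl fun k _ ↦ ?_
    ring
  have hbdeg : ∀ i, (∀ a, r a ≠ i) →
      degLex.degree (b i) ≼[degLex] single (φ i (κ i)) 1 + degLex.degree δ := by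
    intro i hi
    have hP : ∏ k ∈ Finset.univ.erase (κ i), w k ≠ 0 :=
      Finset.prod_ne_zero_iff.2 fun k _ ↦ hw0 k
    have hδdeg : degLex.degree δ = degLex.degree (∏ k ∈ Finset.univ.erase (κ i), w k) +
        degLex.degree (w (κ i)) := by
      rw [hδ, ← Finset.prod_erase_mul _ w (Finset.mem_univ (κ i)),
        degree_mul hP (hw0 _)]
    rw [degree_neg, hδdeg, add_left_comm]
    refine degLex.degree_mul_le.trans ?_
    rw [map_add, map_add degLex.toSyn (degLex.degree _) (single _ 1 + _)]
    refine add_le_add_right (degLex.degree_sum_le.trans (Finset.sup_le fun k _ ↦ ?_)) _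
    rw [degree_mul (X_ne_zero _) (hw0 k), degree_X, hwdeg, hwdeg]
    exact hφ.single_add_positionExponent_le hr hi (hκ i) k
  refine ⟨fun v ↦ if h : ∃ i, (∀ a, r a ≠ i) ∧ v = φ i (κ i) then b h.choose else δ * X v,
    w, δ, hδ0, fun h ↦ hw0 0 (congrFun h 0), fun v ↦ ?_, fun v hv ↦ ?_, fun i ↦ ?_⟩
  · dsimp only
    split_ifs with h
    · have := hbdeg h.choose h.choose_spec.1
      rwa [← h.choose_spec.2] at this
    · rw [degree_mul hδ0 (X_ne_zero _), degree_X, add_comm]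
  · dsimp only
    rw [dif_neg]
    rintro ⟨i, hi, h⟩
    exact hv i hi h
  · have hother : ∀ k, ¬ ((∀ a, r a ≠ i) ∧ k = κ i) →
        ¬ ∃ i', (∀ a, r a ≠ i') ∧ φ i k = φ i' (κ i') := by
      rintro k hk ⟨i', hi', h⟩
      obtain ⟨rfl, h⟩ := hφ.injective h
      exact hk ⟨hi', h⟩
    dsimp only
    by_cases hi : ∀ a, r a ≠ i
    · have hex : ∃ i', (∀ a, r a ≠ i') ∧ φ i (κ i) = φ i' (κ i') := ⟨i, hi, rfl⟩
      rw [← Finset.add_sum_erase _ _ (Finset.mem_univ (κ i)), dif_pos hex,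
        ← (hφ.injective hex.choose_spec.2).1, hb, neg_add_eq_zero]
      refine Finset.sum_congr rfl fun k hk ↦ ?_
      rw [dif_neg (hother k fun h ↦ Finset.ne_of_mem_erase hk h.2)]
    · obtain ⟨a, rfl⟩ : ∃ a, r a = i := by simpa using hi
      have := sum_variableMatrix_mul_minor_eq_zero φ r a
      rw [← mul_zero δ, ← this, Finset.mul_sum]
      refine Finset.sum_congr rfl fun k _ ↦ ?_
      rw [dif_neg (hother k fun h ↦ h.1 a rfl), mul_assoc]

theorem pderiv_ne_zero_and_degree_pderiv {f : MvPolynomial σ ℤ} {v : σ}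
    (hv : degLex.degree f v ≠ 0) :
    pderiv v f ≠ 0 ∧ degLex.degree (pderiv v f) + single v 1 = degLex.degree f := by
  have hf : f ≠ 0 := by
    rintro rfl
    simp at hv
  set u := degLex.degree f with hu
  have hsub : u - single v 1 + single v 1 = u :=
    tsub_add_cancel_of_le (single_le_iff.2 (Nat.one_le_iff_ne_zero.2 hv))
  have hcoeff : coeff (u - single v 1) (pderiv v f) ≠ 0 := by
    rw [coeff_pderiv, hsub]
    exact mul_ne_zero (degLex.coeff_degree_ne_zero_iff.2 hf) (by positivity)
  refine ⟨fun h ↦ hcoeff (by rw [h, coeff_zero]), ?_⟩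
  rw [← hsub]
  congr 1
  refine degLex.toSyn.injective (le_antisymm ?_ (degLex.le_degree (by simpa using hcoeff)))
  refine degLex.degree_le_iff.2 fun d hd ↦ ?_
  have hd' : d + single v 1 ∈ f.support := by
    rw [MvPolynomial.mem_support_iff, coeff_pderiv] at hd
    exact MvPolynomial.mem_support_iff.2 (left_ne_zero_of_mul hd)
  have h := degLex.le_degree hd'
  rw [← hu, ← hsub, map_add, map_add] at h
  exact le_of_add_le_add_right h

/-- The leading monomial of an element of the `s`-th power of the ideal of maximal minors meets
the complement of every prime component of the initial ideal at least `s` times. -/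
theorem IsRowMajor.le_sum_degree {ν : ℕ} {φ : Fin m → Fin (ν + 1) → σ}
    (hφ : IsRowMajor φ) {r : Fin ν → Fin m} (hr : StrictMono r) {κ : Fin m → Fin (ν + 1)}
    (hκ : ∀ i, ∀ a, r a < i ↔ a.castSucc < κ i) {s : ℕ} {f : MvPolynomial σ ℤ}
    (hf : f ∈ minorsIdeal (ν + 1) (variableMatrix φ) ^ s) (hf0 : f ≠ 0) :
    s ≤ ∑ i with ∀ a, r a ≠ i, degLex.degree f (φ i (κ i)) := by
  classical
  induction s generalizing f with
  | zero => exact Nat.zero_le _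
  | succ s ih =>
    by_cases h : ∀ i, (∀ a, r a ≠ i) → degLex.degree f (φ i (κ i)) = 0
    · obtain ⟨e, w, δ, hδ, hw, hdeg, hmul, hsum⟩ := hφ.exists_substitution hr hκ
      refine (aeval_ne_zero_of_degree_le hdeg hδ hf0 (fun v hv ↦ hmul v ?_)
        (aeval_eq_zero_of_mem_minorsIdeal hw hsum
          (Ideal.pow_le_self (Nat.succ_ne_zero s) hf))).elim
      rintro i hi rfl
      exact Finsupp.mem_support_iff.1 hv (h i hi)
    · push Not at h
      obtain ⟨i₀, hi₀, hdeg⟩ := h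
      obtain ⟨hne, hadd⟩ := pderiv_ne_zero_and_degree_pderiv hdeg
      have hs := ih ((pderiv (φ i₀ (κ i₀))).map_mem_pow_of_mem_pow_succ _ hf) hne
      rw [← hadd]
      simp only [Finsupp.add_apply, Finset.sum_add_distrib]
      refine add_le_add hs ?_
      refine le_trans ?_ (Finset.single_le_sum (fun _ _ ↦ Nat.zero_le _)
        (Finset.mem_filter.2 ⟨Finset.mem_univ i₀, hi₀⟩))
      simp

/-- The leading monomial of an element of the `s`-th power of the ideal of maximal minors is
divisible by the leading monomial of a product of `s` maximal minors. -/
theorem IsRowMajor.exists_monic_degree_le {φ : Fin m → Fin n → σ} (hφ : IsRowMajor φ)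
    (hnm : n ≤ m) {s : ℕ} {f : MvPolynomial σ ℤ}
    (hf : f ∈ minorsIdeal n (variableMatrix φ) ^ s) (hf0 : f ≠ 0) :
    ∃ g ∈ minorsIdeal n (variableMatrix φ) ^ s, degLex.Monic g ∧
      degLex.degree g ≤ degLex.degree f ∧
      ∀ v, degLex.degree g v ≠ 0 → ∃ i j, v = φ i j := by
  classical
  cases n with
  | zero =>
    have htop : minorsIdeal 0 (variableMatrix φ) = ⊤ :=
      (Ideal.eq_top_iff_one _).2 (Ideal.subset_span ⟨Fin.elim0, Fin.elim0, by simp⟩)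
    exact ⟨1, by simp [htop, Ideal.top_pow], monic_one, by simp, by simp⟩
  | succ ν =>
    set u := degLex.degree f with hu
    let M : ℕ → ℕ → ℕ := fun i j ↦
      if h : i < m ∧ j < ν + 1 then u (φ ⟨i, h.1⟩ ⟨j, h.2⟩) else 0
    have hM : ∀ (i : Fin m) (j : Fin (ν + 1)), M i j = u (φ i j) := fun i j ↦
      dif_pos ⟨i.2, j.2⟩
    have hcut : s ≤ cutWeight M m ν := by
      obtain ⟨r, κ, hr, hrm, hκ, hle⟩ := exists_cut_le_cutWeight M m ν (Nat.le_of_succ_le hnm)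
      refine le_trans ?_ hle
      have hs := hφ.le_sum_degree (r := fun a : Fin ν ↦ (⟨r a, hrm a a.2⟩ : Fin m))
        (κ := fun i ↦ ⟨κ i, Nat.lt_succ_of_le (hκ i i.2).1⟩)
        (fun a b hab ↦ hr a b hab b.2) (fun i a ↦ (hκ i i.2).2 a a.2) hf hf0
      refine hs.trans_eq ?_
      rw [Finset.sum_filter, Finset.sum_filter, Finset.sum_range]
      refine Finset.sum_congr rfl fun i _ ↦ if_congr ?_ (hM i ⟨κ i, _⟩).symm rfl
      simp [Fin.forall_iff, Fin.ext_iff]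
    obtain ⟨a, ham, halt, hcard⟩ := exists_chains_of_le_cutWeight hcut
    let r : Fin s → Fin (ν + 1) → Fin m := fun t j ↦ ⟨a t j, ham t t.2 j (Nat.le_of_lt_succ j.2)⟩
    have hr : ∀ t, StrictMono (r t) := fun t ↦
      Fin.strictMono_iff_lt_succ.2 fun j ↦ halt t t.2 j j.2
    have hmonic := fun t ↦ hφ.monic_det_and_degree_det (hr t) strictMono_id
    have hdeg : degLex.degree (∏ t, ((variableMatrix φ).submatrix (r t) id).det) =
        ∑ t, positionExponent φ (r t) id := by
      rw [degree_prod fun t _ ↦ (hmonic t).1.ne_zero]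
      exact Finset.sum_congr rfl fun t _ ↦ (hmonic t).2
    have happly : ∀ i j, (∑ t, positionExponent φ (r t) id) (φ i j) ≤ u (φ i j) := by
      intro i j
      refine le_trans (le_of_eq ?_) ((hcard i j (Nat.le_of_lt_succ j.2)).trans_eq (hM i j))
      rw [Finset.card_filter, Finset.sum_range, Finsupp.finsetSum_apply]
      refine Finset.sum_congr rfl fun t _ ↦ ?_
      rw [positionExponent_apply, Finset.sum_eq_single j]
      · refine if_congr ⟨fun h ↦ ?_, fun h ↦ ?_⟩ rfl rfl
        · exact congrArg Fin.val (hφ.injective h).1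
        · exact congrArg (φ · j) (Fin.ext h)
      · exact fun k _ hk ↦ if_neg fun h ↦ hk (hφ.injective h).2
      · simp
    have hsupp : ∀ v, (∑ t, positionExponent φ (r t) id) v ≠ 0 → ∃ i j, v = φ i j := by
      intro v hv
      by_contra! h
      refine hv ?_
      rw [Finsupp.finsetSum_apply]
      refine Finset.sum_eq_zero fun t _ ↦ ?_
      rw [positionExponent_apply]
      exact Finset.sum_eq_zero fun k _ ↦ if_neg fun h' ↦ h _ _ h'.symm
    refine ⟨∏ t, ((variableMatrix φ).submatrix (r t) id).det, ?_, Monic.prod fun t _ ↦ (hmonic t).1,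
      ?_, by rwa [hdeg]⟩
    · have := Ideal.prod_mem_prod (s := Finset.univ)
        (I := fun _ : Fin s ↦ minorsIdeal (ν + 1) (variableMatrix φ))
        (x := fun t ↦ ((variableMatrix φ).submatrix (r t) id).det)
        fun t _ ↦ Ideal.subset_span ⟨r t, id, rfl⟩
      simpa using this
    · rw [hdeg]
      intro v
      by_cases hv : (∑ t, positionExponent φ (r t) id) v = 0
      · rw [hv]
        exact Nat.zero_le _
      · obtain ⟨i, j, rfl⟩ := hsupp v hv
        exact happly i j

theorem IsRowMajor.pow_mul_pow_eq_inf {p q : ℕ} {φ : Fin m → Fin n → σ} {ψ : Fin p → Fin q → σ}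
    (hφ : IsRowMajor φ) (hψ : IsRowMajor ψ) (hdisj : ∀ i j k l, φ i j ≠ ψ k l)
    (hmn : n ≤ m) (hpq : q ≤ p) (s t : ℕ) :
    minorsIdeal n (variableMatrix φ) ^ s * minorsIdeal q (variableMatrix ψ) ^ t =
      minorsIdeal n (variableMatrix φ) ^ s ⊓ minorsIdeal q (variableMatrix ψ) ^ t := by
  refine le_antisymm Ideal.mul_le_inf
    (MonomialOrder.le_of_forall_exists_monic degLex Ideal.mul_le_inf fun f hf hf0 ↦ ?_)
  obtain ⟨g, hg, hgm, hgf, hgs⟩ := hφ.exists_monic_degree_le hmn hf.1 hf0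
  obtain ⟨g', hg', hgm', hgf', hgs'⟩ := hψ.exists_monic_degree_le hpq hf.2 hf0
  refine ⟨g * g', Ideal.mul_mem_mul hg hg', hgm.mul hgm', ?_⟩
  rw [degree_mul hgm.ne_zero hgm'.ne_zero]
  intro v
  by_cases hv : degLex.degree g v = 0
  · simpa [hv] using hgf' v
  · have hv' : degLex.degree g' v = 0 := by
      by_contra hv'
      obtain ⟨i, j, rfl⟩ := hgs v hv
      obtain ⟨k, l, h⟩ := hgs' _ hv'
      exact hdisj i j k l h
    simpa [hv'] using hgf v

end

/-- Let `X` be an `m × n` matrix of indeterminates and `Y` a `p × q` matrix of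
indeterminates, and `R = ℤ[X, Y]`. If `m ≥ n` and `p ≥ q` then, for the ideals of maximal
minors `I(X) = I_n(X)` and `I(Y) = I_q(Y)`, one has `I(X)^q · I(Y)^n = I(X)^q ∩ I(Y)^n`. -/
theorem pow_maximalMinors_mul_eq_inter (m n p q : ℕ) (hmn : n ≤ m) (hpq : q ≤ p)
    (X : Matrix (Fin m) (Fin n) (MvPolynomial ((Fin m × Fin n) ⊕ (Fin p × Fin q)) ℤ))
    (Y : Matrix (Fin p) (Fin q) (MvPolynomial ((Fin m × Fin n) ⊕ (Fin p × Fin q)) ℤ))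
    (hX : ∀ i j, X i j = MvPolynomial.X (Sum.inl (i, j)))
    (hY : ∀ k l, Y k l = MvPolynomial.X (Sum.inr (k, l))) :
    minorsIdeal n X ^ q * minorsIdeal q Y ^ n =
      minorsIdeal n X ^ q ⊓ minorsIdeal q Y ^ n := by
  let φ : Fin m → Fin n → (Fin m × Fin n) ⊕ (Fin p × Fin q) := fun i j ↦ Sum.inl (i, j)
  let ψ : Fin p → Fin q → (Fin m × Fin n) ⊕ (Fin p × Fin q) := fun k l ↦ Sum.inr (k, l)
  obtain rfl : X = variableMatrix φ := Matrix.ext hX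
  obtain rfl : Y = variableMatrix ψ := Matrix.ext hY
  let ι : (Fin m × Fin n) ⊕ (Fin p × Fin q) → (Fin m ×ₗ Fin n) ⊕ₗ (Fin p ×ₗ Fin q) :=
    fun x ↦ toLex (x.map toLex toLex)
  have hι : Function.Injective ι :=
    toLex.injective.comp (Sum.map_injective.2 ⟨toLex.injective, toLex.injective⟩)
  let order : LinearOrder ((Fin m × Fin n) ⊕ (Fin p × Fin q)) := LinearOrder.lift' ι hι
  refine @IsRowMajor.pow_mul_pow_eq_inf m n _ order (@Finite.to_wellFoundedGT _ _ order.toPreorder)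
    p q φ ψ ?_ ?_ (fun _ _ _ _ ↦ Sum.inl_ne_inr) hmn hpq q n
  · intro i j i' j'
    change toLex (Sum.inl (toLex (i, j)) : _ ⊕ (Fin p ×ₗ Fin q)) <
      toLex (Sum.inl (toLex (i', j'))) ↔ _
    rw [Sum.Lex.inl_lt_inl_iff, Prod.Lex.toLex_lt_toLex]
  · intro k l k' l'
    change toLex (Sum.inr (toLex (k, l)) : (Fin m ×ₗ Fin n) ⊕ _) <
      toLex (Sum.inr (toLex (k', l'))) ↔ _
    rw [Sum.Lex.inr_lt_inr_iff, Prod.Lex.toLex_lt_toLex]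
end
end
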